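/- arXiv:1908.01432 — 2 statements merged into one kernel-verified Lean document; each statement's English description precedes it below -/
import Mathlib

section
/- Let G be a graph of order n ≥ 3. Then γ_ri2(G) = n − 1 if and only if G has exactly one connected component G_1 isomorphic to one of S_{n_1−1} (n_1 ≥ 3), S_{n_1−1}^+ (n_1 ≥ 3), S(n_1−3,1) (n_1 ≥ 4), or C_5, where n_1 = |V(G_1)|, and every other connected component of G is isomorphic to K_1 or K_2. -/
open scoped Classical

/-- A `k`-rainbow independent dominating function of `G`: values in `{0,...,k}`,
each nonzero colour class is independent, and every vertex of value `0` has,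
for each `i ∈ {1,...,k}`, a neighbor of value `i`. -/
def IsKRiDF {V : Type*} (G : SimpleGraph V) (k : ℕ) (f : V → ℕ) : Prop :=
  (∀ v, f v ≤ k) ∧
  (∀ i, 1 ≤ i → i ≤ k → ∀ u v, f u = i → f v = i → ¬ G.Adj u v) ∧
  (∀ v, f v = 0 → ∀ i, 1 ≤ i → i ≤ k → ∃ u, G.Adj v u ∧ f u = i)

/-- The weight of a labelling: the number of vertices with nonzero value. -/
noncomputable def riWeight {V : Type*} [Fintype V] (f : V → ℕ) : ℕ :=
  (Finset.univ.filter fun v => f v ≠ 0).card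

/-- The `k`-rainbow independent domination number. -/
noncomputable def riNumber {V : Type*} [Fintype V] (G : SimpleGraph V) (k : ℕ) : ℕ :=
  sInf {w | ∃ f, IsKRiDF G k f ∧ riWeight f = w}

/-- The star `S_m = K_{1,m}` on `Fin (m+1)` with centre `0`. -/
def starGraph (m : ℕ) : SimpleGraph (Fin (m + 1)) :=
  SimpleGraph.fromRel (fun a b => (a : ℕ) = 0 ∧ (b : ℕ) ≠ 0)

/-- The star `S_m` with one extra edge between the leaves `1` and `2`. -/
def starPlusGraph (m : ℕ) : SimpleGraph (Fin (m + 1)) :=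
  SimpleGraph.fromRel (fun a b => ((a : ℕ) = 0 ∧ (b : ℕ) ≠ 0) ∨ ((a : ℕ) = 1 ∧ (b : ℕ) = 2))

/-- The double star `S(n,m)`: centres `0` (with leaves `2,...,n+1`) and `1`
(with leaves `n+2,...,n+m+1`), joined by the bridge `01`. -/
def doubleStar (n m : ℕ) : SimpleGraph (Fin (n + m + 2)) :=
  SimpleGraph.fromRel (fun a b =>
    ((a : ℕ) = 0 ∧ (b : ℕ) = 1) ∨
    ((a : ℕ) = 0 ∧ 2 ≤ (b : ℕ) ∧ (b : ℕ) < n + 2) ∨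
    ((a : ℕ) = 1 ∧ n + 2 ≤ (b : ℕ)))

/-- Two distinct vertices, each adjacent to both classes of a pair of disjoint independent sets,
which we take to be `{a₁, a₂}` and `{b₁, b₂}`. -/
def HasTwoRainbowVertices {V : Type*} (G : SimpleGraph V) : Prop :=
  ∃ z₁ z₂ a₁ a₂ b₁ b₂ : V, z₁ ≠ z₂ ∧ G.Adj z₁ a₁ ∧ G.Adj z₁ b₁ ∧ G.Adj z₂ a₂ ∧ G.Adj z₂ b₂ ∧
    ¬ G.Adj a₁ a₂ ∧ ¬ G.Adj b₁ b₂ ∧ a₁ ≠ b₁ ∧ a₁ ≠ b₂ ∧ a₂ ≠ b₁ ∧ a₂ ≠ b₂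

/-- Some vertex has two distinct neighbours. -/
def HasBranching {V : Type*} (G : SimpleGraph V) : Prop :=
  ∃ z a b : V, G.Adj z a ∧ G.Adj z b ∧ a ≠ b

/-- Two disjoint independent sets extend to the colour classes of a `2`-rainbow independent
dominating function. -/
theorem exists_isKRiDF_two_extending {V : Type*} [Finite V] (G : SimpleGraph V) (A B : Set V)
    (hA : G.IsIndepSet A) (hB : G.IsIndepSet B) (hAB : Disjoint A B) :
    ∃ f : V → ℕ, IsKRiDF G 2 f ∧ (∀ a ∈ A, f a = 1) ∧ (∀ b ∈ B, f b = 2) := by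
  obtain ⟨A', hAA', hA'⟩ := Finite.exists_le_maximal
    (p := fun S : Set V => G.IsIndepSet S ∧ Disjoint S B) ⟨hA, hAB⟩
  obtain ⟨B', hBB', hB'⟩ := Finite.exists_le_maximal
    (p := fun S : Set V => G.IsIndepSet S ∧ Disjoint A' S) ⟨hB, hA'.prop.2⟩
  have hnA : ∀ v, v ∉ A' → v ∉ B → ∃ u, G.Adj v u ∧ u ∈ A' := by
    intro v hv hvB
    by_contra! h
    refine hv (hA'.le_of_ge (y := insert v A') ⟨?_, ?_⟩ (Set.subset_insert _ _)
      (Set.mem_insert _ _))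
    · intro x hx y hy hxy hadj
      rcases hx with rfl | hx <;> rcases hy with rfl | hy
      · exact hxy rfl
      · exact h _ hadj hy
      · exact h _ hadj.symm hx
      · exact hA'.prop.1 hx hy hxy hadj
    · exact Set.disjoint_insert_left.2 ⟨hvB, hA'.prop.2⟩
  have hnB : ∀ v, v ∉ B' → v ∉ A' → ∃ u, G.Adj v u ∧ u ∈ B' := by
    intro v hv hvA
    by_contra! h
    refine hv (hB'.le_of_ge (y := insert v B') ⟨?_, ?_⟩ (Set.subset_insert _ _)
      (Set.mem_insert _ _))
    · intro x hx y hy hxy hadj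
      rcases hx with rfl | hx <;> rcases hy with rfl | hy
      · exact hxy rfl
      · exact h _ hadj hy
      · exact h _ hadj.symm hx
      · exact hB'.prop.1 hx hy hxy hadj
    · exact Set.disjoint_insert_right.2 ⟨hvA, hB'.prop.2⟩
  have hdisj : ∀ v, v ∈ B' → v ∉ A' := fun v hv hv' => Set.disjoint_left.1 hB'.prop.2 hv' hv
  have hf1 : ∀ v, (if v ∈ A' then 1 else if v ∈ B' then 2 else 0) = 1 ↔ v ∈ A' := by
    grind
  have hf2 : ∀ v, (if v ∈ A' then 1 else if v ∈ B' then 2 else 0) = 2 ↔ v ∈ B' := by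
    grind
  refine ⟨fun v => if v ∈ A' then 1 else if v ∈ B' then 2 else 0, ⟨?_, ?_, ?_⟩, ?_, ?_⟩
  · intro v
    dsimp only
    split_ifs <;> omega
  · intro i h1 h2 u v hu hv hadj
    interval_cases i
    · exact hA'.prop.1 ((hf1 u).1 hu) ((hf1 v).1 hv) hadj.ne hadj
    · exact hB'.prop.1 ((hf2 u).1 hu) ((hf2 v).1 hv) hadj.ne hadj
  · intro v hv i h1 h2
    have hvA : v ∉ A' := by grind
    have hvB : v ∉ B' := by grind
    interval_cases i
    · obtain ⟨u, hu, huA⟩ := hnA v hvA fun h => hvB (hBB' h)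
      exact ⟨u, hu, (hf1 u).2 huA⟩
    · obtain ⟨u, hu, huB⟩ := hnB v hvB hvA
      exact ⟨u, hu, (hf2 u).2 huB⟩
  · exact fun a ha => (hf1 a).2 (hAA' ha)
  · exact fun b hb => (hf2 b).2 (hBB' hb)

theorem IsKRiDF.eq_zero_of_adj_one_two {V : Type*} {G : SimpleGraph V} {f : V → ℕ}
    (hf : IsKRiDF G 2 f) {z a b : V} (ha : G.Adj z a) (hb : G.Adj z b) (hfa : f a = 1)
    (hfb : f b = 2) : f z = 0 := by
  have h1 := hf.1 z
  by_contra h0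
  obtain h | h : f z = 1 ∨ f z = 2 := by omega
  · exact hf.2.1 1 le_rfl (by norm_num) z a h hfa ha
  · exact hf.2.1 2 (by norm_num) le_rfl z b h hfb hb

theorem riWeight_add_card_zeros {V : Type*} [Fintype V] (f : V → ℕ) :
    riWeight f + (Finset.univ.filter fun v => f v = 0).card = Fintype.card V := by
  rw [add_comm, riWeight]
  exact Finset.card_filter_add_card_filter_not (s := Finset.univ) (fun v => f v = 0)

theorem exists_riWeight_eq_riNumber_two {V : Type*} [Fintype V] (G : SimpleGraph V) :
    ∃ f, IsKRiDF G 2 f ∧ riWeight f = riNumber G 2 := by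
  obtain ⟨f, hf, -⟩ := exists_isKRiDF_two_extending G ∅ ∅ (by simp [SimpleGraph.IsIndepSet])
    (by simp [SimpleGraph.IsIndepSet]) (by simp)
  exact Nat.sInf_mem (s := {w | ∃ f, IsKRiDF G 2 f ∧ riWeight f = w}) ⟨_, f, hf, rfl⟩

theorem riNumber_le_riWeight {V : Type*} [Fintype V] {G : SimpleGraph V} {k : ℕ} {f : V → ℕ}
    (hf : IsKRiDF G k f) : riNumber G k ≤ riWeight f :=
  Nat.sInf_le ⟨f, hf, rfl⟩

theorem HasTwoRainbowVertices.riNumber_add_two_le {V : Type*} [Fintype V] {G : SimpleGraph V}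
    (h : HasTwoRainbowVertices G) : riNumber G 2 + 2 ≤ Fintype.card V := by
  obtain ⟨z₁, z₂, a₁, a₂, b₁, b₂, hz, h1, h2, h3, h4, ha, hb, n1, n2, n3, n4⟩ := h
  obtain ⟨f, hf, hfA, hfB⟩ := exists_isKRiDF_two_extending G {a₁, a₂} {b₁, b₂}
    (Set.pairwise_pair.2 fun _ => ⟨ha, fun h => ha h.symm⟩)
    (Set.pairwise_pair.2 fun _ => ⟨hb, fun h => hb h.symm⟩)
    (by simp [n1.symm, n2.symm, n3.symm, n4.symm])
  have hz₁ := hf.eq_zero_of_adj_one_two h1 h2 (hfA _ (by simp)) (hfB _ (by simp))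
  have hz₂ := hf.eq_zero_of_adj_one_two h3 h4 (hfA _ (by simp)) (hfB _ (by simp))
  have hw := riWeight_add_card_zeros f
  have hle := riNumber_le_riWeight hf
  have : 1 < (Finset.univ.filter fun v => f v = 0).card :=
    Finset.one_lt_card.2 ⟨z₁, by simpa using hz₁, z₂, by simpa using hz₂, hz⟩
  omega

theorem HasBranching.riNumber_add_one_le {V : Type*} [Fintype V] {G : SimpleGraph V}
    (h : HasBranching G) : riNumber G 2 + 1 ≤ Fintype.card V := by
  obtain ⟨z, a, b, ha, hb, hab⟩ := h
  obtain ⟨f, hf, hfA, hfB⟩ := exists_isKRiDF_two_extending G {a} {b}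
    (Set.pairwise_singleton _ _) (Set.pairwise_singleton _ _) (by simpa using hab)
  have hz := hf.eq_zero_of_adj_one_two ha hb (hfA _ (by simp)) (hfB _ (by simp))
  have hw := riWeight_add_card_zeros f
  have hle := riNumber_le_riWeight hf
  have : 0 < (Finset.univ.filter fun v => f v = 0).card :=
    Finset.card_pos.2 ⟨z, by simpa using hz⟩
  omega

theorem riNumber_two_add_one_eq_card_iff {V : Type*} [Fintype V] (G : SimpleGraph V) :
    riNumber G 2 + 1 = Fintype.card V ↔ ¬ HasTwoRainbowVertices G ∧ HasBranching G := by
  obtain ⟨f, hf, hfw⟩ := exists_riWeight_eq_riNumber_two G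
  have hw := riWeight_add_card_zeros f
  constructor
  · intro h
    refine ⟨fun hT => by have := hT.riNumber_add_two_le; omega, ?_⟩
    obtain ⟨z, hz⟩ := Finset.card_pos.1
      (show 0 < (Finset.univ.filter fun v => f v = 0).card by omega)
    have hz : f z = 0 := by simpa using hz
    obtain ⟨a, ha, ha'⟩ := hf.2.2 z hz 1 le_rfl (by norm_num)
    obtain ⟨b, hb, hb'⟩ := hf.2.2 z hz 2 (by norm_num) le_rfl
    exact ⟨z, a, b, ha, hb, by rintro rfl; omega⟩
  · rintro ⟨hT, hB⟩
    have := hB.riNumber_add_one_le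
    by_contra hne
    obtain ⟨z₁, hz₁, z₂, hz₂, hz⟩ := Finset.one_lt_card.1
      (show 1 < (Finset.univ.filter fun v => f v = 0).card by omega)
    have hz₁ : f z₁ = 0 := by simpa using hz₁
    have hz₂ : f z₂ = 0 := by simpa using hz₂
    obtain ⟨a₁, ha₁, fa₁⟩ := hf.2.2 z₁ hz₁ 1 le_rfl (by norm_num)
    obtain ⟨b₁, hb₁, fb₁⟩ := hf.2.2 z₁ hz₁ 2 (by norm_num) le_rfl
    obtain ⟨a₂, ha₂, fa₂⟩ := hf.2.2 z₂ hz₂ 1 le_rfl (by norm_num)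
    obtain ⟨b₂, hb₂, fb₂⟩ := hf.2.2 z₂ hz₂ 2 (by norm_num) le_rfl
    refine hT ⟨z₁, z₂, a₁, a₂, b₁, b₂, hz, ha₁, hb₁, ha₂, hb₂,
      hf.2.1 1 le_rfl (by norm_num) _ _ fa₁ fa₂, hf.2.1 2 (by norm_num) le_rfl _ _ fb₁ fb₂,
      ?_, ?_, ?_, ?_⟩ <;> rintro rfl <;> omega

/-- `G` is a star. -/
def IsStar {V : Type*} (G : SimpleGraph V) : Prop :=
  ∃ v, ∀ a b, G.Adj a b ↔ (a = v ∧ b ≠ v) ∨ (b = v ∧ a ≠ v)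

/-- `G` is a star with centre `v` and one extra edge `xy`. -/
def IsStarPlus {V : Type*} (G : SimpleGraph V) : Prop :=
  ∃ v x y, v ≠ x ∧ v ≠ y ∧ x ≠ y ∧ ∀ a b, G.Adj a b ↔
    (a = v ∧ b ≠ v) ∨ (b = v ∧ a ≠ v) ∨ (a = x ∧ b = y) ∨ (a = y ∧ b = x)

/-- `G` is a star with centre `v` and a leaf `w` attached to the leaf `x`, where `x` is not the only
leaf of the star. -/
def IsStarWithPendant {V : Type*} (G : SimpleGraph V) : Prop :=
  ∃ v x w u, v ≠ x ∧ v ≠ w ∧ x ≠ w ∧ u ≠ v ∧ u ≠ x ∧ u ≠ w ∧ ∀ a b, G.Adj a b ↔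
    (a = v ∧ b ≠ v ∧ b ≠ w) ∨ (b = v ∧ a ≠ v ∧ a ≠ w) ∨ (a = x ∧ b = w) ∨ (a = w ∧ b = x)

theorem SimpleGraph.Connected.mem_of_adj_closed {V : Type*} {G : SimpleGraph V} (hG : G.Connected)
    {S : Set V} {v : V} (hv : v ∈ S) (hS : ∀ a ∈ S, ∀ b, G.Adj a b → b ∈ S) (u : V) : u ∈ S := by
  obtain ⟨p⟩ := hG.preconnected v u
  induction p with
  | nil => exact hv
  | cons h _ ih => exact ih (hS _ hv _ h)

theorem HasTwoRainbowVertices.of_common_neighbors {V : Type*} {G : SimpleGraph V} {x y p q : V}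
    (hxy : x ≠ y) (hpq : p ≠ q) (hxp : G.Adj x p) (hxq : G.Adj x q) (hyp : G.Adj y p)
    (hyq : G.Adj y q) : HasTwoRainbowVertices G :=
  ⟨x, y, p, p, q, q, hxy, hxp, hxq, hyp, hyq, G.irrefl, G.irrefl, hpq, hpq, hpq, hpq⟩

/-- The classification of connected graphs in which every vertex with two neighbours lies in the
closed neighbourhood of a vertex `v`, and the neighbours of `v` have few other neighbours. -/
theorem star_or_starPlus_or_starWithPendant {V : Type*} {G : SimpleGraph V} (hG : G.Connected)
    {v a₀ b₀ : V} (ha₀ : G.Adj v a₀) (hb₀ : G.Adj v b₀) (hab₀ : a₀ ≠ b₀)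
    (h₁ : ∀ x p q, x ≠ v → ¬ G.Adj v x → G.Adj x p → G.Adj x q → p = q)
    (h₂ : ∀ x p q, G.Adj v x → G.Adj x p → G.Adj x q → p ≠ v → q ≠ v → p = q)
    (h₃ : ∀ x y p q, G.Adj v x → G.Adj v y → x ≠ y → ¬ G.Adj x y → G.Adj x p → G.Adj y q →
      p ≠ v → q ≠ v → False) :
    IsStar G ∨ IsStarPlus G ∨ IsStarWithPendant G := by
  have hirr : ∀ a, ¬ G.Adj a a := fun a => G.irrefl
  have hsymm : ∀ a b, G.Adj a b → G.Adj b a := fun a b h => h.symm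
  have hdist : ∀ u, u = v ∨ G.Adj v u ∨ ∃ x, G.Adj v x ∧ G.Adj x u := by
    refine hG.mem_of_adj_closed (S := {u | u = v ∨ G.Adj v u ∨ ∃ x, G.Adj v x ∧ G.Adj x u})
      (Or.inl rfl) ?_
    rintro a (rfl | ha | ⟨x, hx, hxa⟩) b hab
    · exact Or.inr (Or.inl hab)
    · exact Or.inr (Or.inr ⟨a, ha, hab⟩)
    · by_cases hav : a = v
      · exact Or.inr (Or.inl (hav ▸ hab))
      by_cases hva : G.Adj v a
      · exact Or.inr (Or.inr ⟨a, hva, hab⟩)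
      · exact Or.inr (Or.inl (h₁ a x b hav hva hxa.symm hab ▸ hx))
  by_cases hA : ∀ x w, G.Adj v x → G.Adj x w → w = v
  · refine Or.inl ⟨v, fun a b => ?_⟩
    have := hdist a
    have := hdist b
    grind
  push Not at hA
  obtain ⟨x, w, hvx, hxw, hwv⟩ := hA
  by_cases hvw : G.Adj v w
  · refine Or.inr (Or.inl ⟨v, x, w, hvx.ne, hwv.symm, hxw.ne, ?_⟩)
    have hleaf : ∀ y q, G.Adj v y → y ≠ x → y ≠ w → G.Adj y q → q = v := by
      intro y q hy hyx hyw hyq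
      by_contra hq
      refine h₃ x y w q hvx hy hyx.symm (fun h => hyw ?_) hxw hyq hwv hq
      exact h₂ x y w hvx h hxw hy.ne' hwv
    have hnbr : ∀ u, u ≠ v → G.Adj v u := by
      intro u hu
      obtain h | h | ⟨y, hy, hyu⟩ := hdist u
      · exact absurd h hu
      · exact h
      by_cases hyx : y = x
      · subst hyx
        exact h₂ y w u hvx hxw hyu hwv hu ▸ hvw
      by_cases hyw : y = w
      · subst hyw
        exact h₂ y x u hvw hxw.symm hyu hvx.ne' hu ▸ hvx
      · exact absurd (hleaf y u hy hyx hyw hyu) hu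
    have hx : ∀ q, G.Adj x q → q ≠ v → q = w := fun q hq hqv => h₂ x q w hvx hq hxw hqv hwv
    have hw : ∀ q, G.Adj w q → q ≠ v → q = x :=
      fun q hq hqv => h₂ w q x hvw hq hxw.symm hqv hvx.ne'
    clear h₁ h₂ h₃ hdist
    intro a b
    have := hnbr a
    have := hnbr b
    grind
  · obtain ⟨u, hvu, hux⟩ : ∃ u, G.Adj v u ∧ u ≠ x := by grind
    refine Or.inr (Or.inr ⟨v, x, w, u, hvx.ne, hwv.symm, hxw.ne, hvu.ne', hux, by grind, ?_⟩)
    have hleaf : ∀ y q, G.Adj v y → y ≠ x → G.Adj y q → q = v := by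
      intro y q hy hyx hyq
      by_contra hq
      refine h₃ x y w q hvx hy hyx.symm (fun h => hvw ?_) hxw hyq hwv hq
      exact h₂ x y w hvx h hxw hy.ne' hwv ▸ hy
    have hnbr : ∀ u, u ≠ v → u ≠ w → G.Adj v u := by
      intro u hu huw
      obtain h | h | ⟨y, hy, hyu⟩ := hdist u
      · exact absurd h hu
      · exact h
      by_cases hyx : y = x
      · subst hyx
        exact absurd (h₂ y u w hvx hyu hxw hu hwv) huw
      · exact absurd (hleaf y u hy hyx hyu) hu
    have hw : ∀ q, G.Adj w q → q = x := fun q hq => h₁ w q x hwv hvw hq hxw.symm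
    have hx : ∀ q, G.Adj x q → q ≠ v → q = w := fun q hq hqv => h₂ x q w hvx hq hxw hqv hwv
    clear h₁ h₂ h₃ hdist
    intro a b
    have := hnbr a
    have := hnbr b
    grind

theorem exists_ne_and_not_and_not {α : Type*} {S P Q : α → Prop} {a b c : α} (ha : S a) (hb : S b)
    (hc : S c) (hab : a ≠ b) (hac : a ≠ c) (hbc : b ≠ c)
    (hP : ∀ x y, S x → S y → P x → P y → x = y) (hQ : ∀ x y, S x → S y → Q x → Q y → x = y) :
    ∃ x y, S x ∧ S y ∧ x ≠ y ∧ ¬ P x ∧ ¬ Q y := by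
  have := hP a b ha hb
  have := hP a c ha hc
  have := hP b c hb hc
  have := hQ a b ha hb
  have := hQ a c ha hc
  have := hQ b c hb hc
  by_contra! h
  have := h a b ha hb hab
  have := h a c ha hc hac
  have := h b a hb ha hab.symm
  have := h b c hb hc hbc
  have := h c a hc ha hac.symm
  have := h c b hc hb hbc.symm
  clear h hP hQ
  by_cases P a <;> by_cases P b <;> grind

theorem star_classification_of_three_neighbors {V : Type*} {G : SimpleGraph V} (hG : G.Connected)
    (hT : ¬ HasTwoRainbowVertices G) {v a₀ b₀ c₀ : V} (ha₀ : G.Adj v a₀) (hb₀ : G.Adj v b₀)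
    (hc₀ : G.Adj v c₀) (hab₀ : a₀ ≠ b₀) (hac₀ : a₀ ≠ c₀) (hbc₀ : b₀ ≠ c₀) :
    IsStar G ∨ IsStarPlus G ∨ IsStarWithPendant G := by
  have hirr : ∀ a, ¬ G.Adj a a := fun a => G.irrefl
  have hsymm : ∀ a b, G.Adj a b → G.Adj b a := fun a b h => h.symm
  have hC : ∀ x y p q, x ≠ y → G.Adj x p → G.Adj x q → G.Adj y p → G.Adj y q → p = q := by
    intro x y p q hxy hxp hxq hyp hyq
    by_contra hpq
    exact hT (.of_common_neighbors hxy hpq hxp hxq hyp hyq)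
  have hT' : ∀ z₁ z₂ a₁ a₂ b₁ b₂, z₁ ≠ z₂ → G.Adj z₁ a₁ → G.Adj z₁ b₁ → G.Adj z₂ a₂ →
      G.Adj z₂ b₂ → ¬ G.Adj a₁ a₂ → ¬ G.Adj b₁ b₂ → a₁ ≠ b₁ → a₁ ≠ b₂ → a₂ ≠ b₁ → a₂ ≠ b₂ →
      False := fun z₁ z₂ a₁ a₂ b₁ b₂ h0 h1 h2 h3 h4 h5 h6 h7 h8 h9 h10 =>
    hT ⟨z₁, z₂, a₁, a₂, b₁, b₂, h0, h1, h2, h3, h4, h5, h6, h7, h8, h9, h10⟩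
  have havoid : ∀ p, ∃ a b, G.Adj v a ∧ G.Adj v b ∧ a ≠ b ∧ a ≠ p ∧ b ≠ p := fun p =>
    exists_ne_and_not_and_not (P := (· = p)) (Q := (· = p)) ha₀ hb₀ hc₀ hab₀ hac₀ hbc₀
      (by grind) (by grind)
  have hone : ∀ x p q, x ≠ v → ¬ G.Adj v x → G.Adj x p → G.Adj x q → p ≠ q → ¬ G.Adj v p := by
    intro x p q hxv hvx hxp hxq hpq hvp
    have hvq : ¬ G.Adj v q := fun hvq => hpq (hC x v p q hxv hxp hxq hvp hvq)
    obtain ⟨b, hb, hbp, hbq⟩ : ∃ b, G.Adj v b ∧ b ≠ p ∧ ¬ G.Adj b q := by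
      by_contra! h
      obtain ⟨b, b', hb, hb', hbb', hbp, hbp'⟩ := havoid p
      exact hbb' (hC v q b b' (by grind) hb hb' (h b hb hbp).symm (h b' hb' hbp').symm)
    exact hT' v x p p b q hxv.symm hvp hb hxp hxq (hirr p) hbq hbp.symm hpq hbp.symm hpq
  have hone' : ∀ x p q, G.Adj v x → G.Adj x p → G.Adj x q → p ≠ v → q ≠ v → p ≠ q →
      ¬ G.Adj v p := by
    intro x p q hvx hxp hxq hpv hqv hpq hvp
    obtain ⟨b, hb, hbp, hbx⟩ : ∃ b, G.Adj v b ∧ b ≠ p ∧ b ≠ x := by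
      obtain ⟨b, b', hb, hb', hbb', hbp, hbp'⟩ := havoid p
      by_cases h : b = x
      · exact ⟨b', hb', hbp', by grind⟩
      · exact ⟨b, hb, hbp, h⟩
    refine hT' v x p p b q hvx.ne hvp hb hxp hxq (hirr p) (fun hbq => ?_) hbp.symm hpq hbp.symm hpq
    exact hbx (hC v q b x hqv.symm hb hvx hbq.symm hxq.symm)
  have h₁ : ∀ x p q, x ≠ v → ¬ G.Adj v x → G.Adj x p → G.Adj x q → p = q := by
    intro x p q hxv hvx hxp hxq
    by_contra hpq
    have hvp := hone x p q hxv hvx hxp hxq hpq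
    have hvq := hone x q p hxv hvx hxq hxp (Ne.symm hpq)
    have hp : ∀ b b', G.Adj v b → G.Adj v b' → G.Adj b p → G.Adj b' p → b = b' :=
      fun b b' hb hb' h h' => hC v p b b' (by grind) hb hb' h.symm h'.symm
    have hq : ∀ b b', G.Adj v b → G.Adj v b' → G.Adj b q → G.Adj b' q → b = b' :=
      fun b b' hb hb' h h' => hC v q b b' (by grind) hb hb' h.symm h'.symm
    obtain ⟨a, b, ha, hb, hab, hap, hbq⟩ :=
      exists_ne_and_not_and_not ha₀ hb₀ hc₀ hab₀ hac₀ hbc₀ hp hq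
    exact hT' v x a p b q hxv.symm ha hb hxp hxq hap hbq hab (by grind) (by grind) hpq
  have h₂ : ∀ x p q, G.Adj v x → G.Adj x p → G.Adj x q → p ≠ v → q ≠ v → p = q := by
    intro x p q hvx hxp hxq hpv hqv
    by_contra hpq
    have hvp := hone' x p q hvx hxp hxq hpv hqv hpq
    have hvq := hone' x q p hvx hxq hxp hqv hpv (Ne.symm hpq)
    obtain ⟨a, b, ha, hb, hab, hax, hbx⟩ := havoid x
    refine hT' v x a p b q hvx.ne ha hb hxp hxq (fun h => hax ?_) (fun h => hbx ?_) hab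
      (by grind) (by grind) hpq
    · exact hC v p a x hpv.symm ha hvx h.symm hxp.symm
    · exact hC v q b x hqv.symm hb hvx h.symm hxq.symm
  refine star_or_starPlus_or_starWithPendant hG ha₀ hb₀ hab₀ h₁ h₂ ?_
  intro x y p q hvx hvy hxy hnxy hxp hyq hpv hqv
  have hqx : q ≠ x := fun h => hnxy (h ▸ hyq).symm
  have hpq : p ≠ q := by
    rintro rfl
    exact hxy (hC v p x y hpv.symm hvx hvy hxp.symm hyq.symm)
  refine hT' x y v v p q hxy hvx.symm hxp hvy.symm hyq (hirr v) (fun h => ?_) hpv.symm hqv.symm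
    hpv.symm hqv.symm
  have hvp : G.Adj v p := by
    by_contra hvp
    exact hqx (h₁ p q x hpv hvp h hxp.symm)
  exact hqx (h₂ p q x hvp h hxp.symm hqv hvx.ne')


/-- `G` is a cycle of length five. -/
def IsFiveCycle {V : Type*} (G : SimpleGraph V) : Prop :=
  ∃ p : Fin 5 → V, Function.Bijective p ∧ ∀ i j, G.Adj (p i) (p j) ↔ i - j = 1 ∨ j - i = 1

theorem isFiveCycle_of_adj {V : Type*} {G : SimpleGraph V} (hG : G.Connected)
    (hdeg : ∀ v a b c, G.Adj v a → G.Adj v b → G.Adj v c → a = b ∨ a = c ∨ b = c)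
    {p : Fin 5 → V} (hp : Function.Injective p) (hadj : ∀ i, G.Adj (p i) (p (i + 1))) :
    IsFiveCycle G := by
  have hnbr : ∀ i u, G.Adj (p i) u → u = p (i + 1) ∨ u = p (i - 1) := by
    intro i u hu
    have h1 := hadj (i - 1)
    rw [sub_add_cancel] at h1
    have hne : p (i + 1) ≠ p (i - 1) := fun h => by
      exact (by decide : ∀ i : Fin 5, i + 1 ≠ i - 1) i (hp h)
    have := hdeg _ _ _ _ hu (hadj i) h1.symm
    tauto
  refine ⟨p, ⟨hp, ?_⟩, fun i j => ⟨fun h => ?_, ?_⟩⟩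
  · refine hG.mem_of_adj_closed (S := Set.range p) ⟨0, rfl⟩ ?_
    rintro _ ⟨i, rfl⟩ b hb
    obtain rfl | rfl := hnbr i b hb
    exacts [⟨_, rfl⟩, ⟨_, rfl⟩]
  · obtain h | h := hnbr i _ h
    · exact Or.inr (by rw [hp h]; exact add_sub_cancel_left i 1)
    · exact Or.inl (by rw [hp h]; exact sub_sub_cancel i 1)
  · rintro (h | h)
    · rw [← sub_add_cancel i j, h, add_comm]
      exact (hadj j).symm
    · rw [← sub_add_cancel j i, h, add_comm]
      exact hadj i

theorem classification_of_degree_le_two {V : Type*} {G : SimpleGraph V} (hG : G.Connected)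
    (hT : ¬ HasTwoRainbowVertices G)
    (hdeg : ∀ v a b c, G.Adj v a → G.Adj v b → G.Adj v c → a = b ∨ a = c ∨ b = c)
    {v a b : V} (ha : G.Adj v a) (hb : G.Adj v b) (hab : a ≠ b) :
    IsStar G ∨ IsStarPlus G ∨ IsStarWithPendant G ∨ IsFiveCycle G := by
  by_cases hF : IsFiveCycle G
  · exact Or.inr (Or.inr (Or.inr hF))
  have hirr : ∀ a, ¬ G.Adj a a := fun a => G.irrefl
  have hC : ∀ x y p q, x ≠ y → G.Adj x p → G.Adj x q → G.Adj y p → G.Adj y q → p = q := by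
    intro x y p q hxy hxp hxq hyp hyq
    by_contra hpq
    exact hT (.of_common_neighbors hxy hpq hxp hxq hyp hyq)
  have hT' : ∀ z₁ z₂ a₁ a₂ b₁ b₂, z₁ ≠ z₂ → G.Adj z₁ a₁ → G.Adj z₁ b₁ → G.Adj z₂ a₂ →
      G.Adj z₂ b₂ → ¬ G.Adj a₁ a₂ → ¬ G.Adj b₁ b₂ → a₁ ≠ b₁ → a₁ ≠ b₂ → a₂ ≠ b₁ → a₂ ≠ b₂ →
      False := fun z₁ z₂ a₁ a₂ b₁ b₂ h0 h1 h2 h3 h4 h5 h6 h7 h8 h9 h10 =>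
    hT ⟨z₁, z₂, a₁, a₂, b₁, b₂, h0, h1, h2, h3, h4, h5, h6, h7, h8, h9, h10⟩
  /- a path on five vertices cannot have nonadjacent ends, and if its ends are adjacent then it is a
  spanning cycle -/
  have hpath : ∀ e x u y f, G.Adj u x → G.Adj u y → G.Adj x e → G.Adj y f → x ≠ y → e ≠ u →
      f ≠ u → e ≠ f → e ≠ y → f ≠ x → False := by
    intro e x u y f hux huy hxe hyf hxy heu hfu hef hey hfx
    refine hT' x y u u e f hxy hux.symm hxe huy.symm hyf (hirr u) (fun h => hF ?_) heu.symm
      hfu.symm heu.symm hfu.symm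
    have hnodup : [u, x, e, f, y].Nodup := by
      simp [hux.ne, huy.ne, hxe.ne, hyf.ne', hxy, heu.symm, hfu.symm, hef, hey, hfx.symm]
    refine isFiveCycle_of_adj hG hdeg (p := fun i : Fin 5 => [u, x, e, f, y].get i)
      (List.nodup_iff_injective_get.1 hnodup) ?_
    intro i
    fin_cases i
    exacts [hux, hxe, h, hyf.symm, huy.symm]
  have hmid : ∀ x p q, x ≠ v → ¬ G.Adj v x → G.Adj x p → G.Adj x q → p ≠ q → ¬ G.Adj v p := by
    intro x p q hxv hvx hxp hxq hpq hvp
    obtain ⟨c, hc, hcp⟩ : ∃ c, G.Adj v c ∧ c ≠ p := by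
      by_cases h : a = p
      · exact ⟨b, hb, fun h' => hab (h.trans h'.symm)⟩
      · exact ⟨a, ha, h⟩
    refine hpath c v p x q hvp.symm hxp.symm hc hxq hxv.symm hcp hpq.symm ?_ ?_ ?_
    · rintro rfl
      exact hcp (hC v x c p hxv.symm hc hvp hxq hxp)
    · rintro rfl
      exact hvx hc
    · rintro rfl
      exact hvx hxq.symm
  have h := star_or_starPlus_or_starWithPendant hG ha hb hab ?_ ?_ ?_
  · tauto
  · intro x p q hxv hvx hxp hxq
    by_contra hpq
    have hvp := hmid x p q hxv hvx hxp hxq hpq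
    have hvq := hmid x q p hxv hvx hxq hxp (Ne.symm hpq)
    have hap : a ≠ p := fun h => hvp (h ▸ ha)
    have haq : a ≠ q := fun h => hvq (h ▸ ha)
    have hbp : b ≠ p := fun h => hvp (h ▸ hb)
    have hbq : b ≠ q := fun h => hvq (h ▸ hb)
    have hax : a ≠ x := fun h => hvx (h ▸ ha)
    have hbx : b ≠ x := fun h => hvx (h ▸ hb)
    have hvp' : v ≠ p := fun h => hvx (h ▸ hxp).symm
    have hvq' : v ≠ q := fun h => hvx (h ▸ hxq).symm
    have hpar : G.Adj a p ∨ G.Adj b q := by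
      by_contra! h
      exact hT' v x a p b q hxv.symm ha hb hxp hxq h.1 h.2 hab haq hbp.symm hpq
    have hcross : G.Adj a q ∨ G.Adj b p := by
      by_contra! h
      exact hT' v x a q b p hxv.symm ha hb hxq hxp h.1 h.2 hab hap hbq.symm (Ne.symm hpq)
    rcases hpar with h | h <;> rcases hcross with h' | h'
    · rcases hdeg a v p q ha.symm h h' with e | e | e
      exacts [hvp' e, hvq' e, hpq e]
    · rcases hdeg p x a b hxp.symm h.symm h'.symm with e | e | e
      exacts [hax e.symm, hbx e.symm, hab e]
    · rcases hdeg q x a b hxq.symm h'.symm h.symm with e | e | e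
      exacts [hax e.symm, hbx e.symm, hab e]
    · rcases hdeg b v p q hb.symm h' h with e | e | e
      exacts [hvp' e, hvq' e, hpq e]
  · intro x p q hvx hxp hxq hpv hqv
    rcases hdeg x p q v hxp hxq hvx.symm with e | e | e
    exacts [e, absurd e hpv, absurd e hqv]
  · intro x y p q hvx hvy hxy hnxy hxp hyq hpv hqv
    refine hpath p x v y q hvx hvy hxp hyq hxy hpv hqv ?_ ?_ ?_
    · rintro rfl
      exact hxy (hC v p x y hpv.symm hvx hvy hxp.symm hyq.symm)
    · rintro rfl
      exact hnxy hxp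
    · rintro rfl
      exact hnxy hyq.symm

theorem starGraph_adj {m : ℕ} {a b : Fin (m + 1)} : (starGraph m).Adj a b ↔
    ((a : ℕ) = 0 ∧ (b : ℕ) ≠ 0) ∨ ((b : ℕ) = 0 ∧ (a : ℕ) ≠ 0) := by
  rw [starGraph, SimpleGraph.fromRel_adj, Ne, Fin.ext_iff]
  omega

theorem starPlusGraph_adj {m : ℕ} {a b : Fin (m + 1)} : (starPlusGraph m).Adj a b ↔
    ((a : ℕ) = 0 ∧ (b : ℕ) ≠ 0) ∨ ((b : ℕ) = 0 ∧ (a : ℕ) ≠ 0) ∨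
      ((a : ℕ) = 1 ∧ (b : ℕ) = 2) ∨ ((a : ℕ) = 2 ∧ (b : ℕ) = 1) := by
  rw [starPlusGraph, SimpleGraph.fromRel_adj, Ne, Fin.ext_iff]
  omega

theorem doubleStar_one_adj {m : ℕ} {a b : Fin (m + 1 + 2)} : (doubleStar m 1).Adj a b ↔
    ((a : ℕ) = 0 ∧ (b : ℕ) ≠ 0 ∧ (b : ℕ) ≠ m + 2) ∨
      ((b : ℕ) = 0 ∧ (a : ℕ) ≠ 0 ∧ (a : ℕ) ≠ m + 2) ∨
      ((a : ℕ) = 1 ∧ (b : ℕ) = m + 2) ∨ ((a : ℕ) = m + 2 ∧ (b : ℕ) = 1) := by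
  rw [doubleStar, SimpleGraph.fromRel_adj, Ne, Fin.ext_iff]
  omega

theorem not_hasTwoRainbowVertices_starGraph (m : ℕ) :
    ¬ HasTwoRainbowVertices (starGraph m) := by
  rintro ⟨z₁, z₂, a₁, a₂, b₁, b₂, hz, h1, h2, h3, h4, ha, hb, n1, n2, n3, n4⟩
  simp only [starGraph_adj, Ne, Fin.ext_iff] at *
  omega

theorem not_hasTwoRainbowVertices_starPlusGraph (m : ℕ) :
    ¬ HasTwoRainbowVertices (starPlusGraph m) := by
  rintro ⟨z₁, z₂, a₁, a₂, b₁, b₂, hz, h1, h2, h3, h4, ha, hb, n1, n2, n3, n4⟩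
  simp only [starPlusGraph_adj, Ne, Fin.ext_iff] at *
  grind

theorem not_hasTwoRainbowVertices_doubleStar_one (m : ℕ) :
    ¬ HasTwoRainbowVertices (doubleStar m 1) := by
  rintro ⟨z₁, z₂, a₁, a₂, b₁, b₂, hz, h1, h2, h3, h4, ha, hb, n1, n2, n3, n4⟩
  simp only [doubleStar_one_adj, Ne, Fin.ext_iff] at *
  grind

theorem not_hasTwoRainbowVertices_cycleGraph_five :
    ¬ HasTwoRainbowVertices (SimpleGraph.cycleGraph 5) := by
  rintro ⟨z₁, z₂, a₁, a₂, b₁, b₂, hz, h1, h2, h3, h4, ha, hb, n1, n2, n3, n4⟩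
  have key : ∀ z₁ z₂ : Fin 5, z₁ ≠ z₂ →
      ∀ a₁, (z₁ - a₁ = 1 ∨ a₁ - z₁ = 1) → ∀ b₁, (z₁ - b₁ = 1 ∨ b₁ - z₁ = 1) → a₁ ≠ b₁ →
      ∀ a₂, (z₂ - a₂ = 1 ∨ a₂ - z₂ = 1) → ¬ (a₁ - a₂ = 1 ∨ a₂ - a₁ = 1) → a₂ ≠ b₁ →
      ∀ b₂, (z₂ - b₂ = 1 ∨ b₂ - z₂ = 1) → ¬ (b₁ - b₂ = 1 ∨ b₂ - b₁ = 1) → a₁ ≠ b₂ →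
      a₂ = b₂ := by decide
  exact n4 (key z₁ z₂ hz a₁ h1 b₁ h2 n1 a₂ h3 ha n3 b₂ h4 hb n2)

theorem HasTwoRainbowVertices.map {V W : Type*} {G : SimpleGraph V} {H : SimpleGraph W}
    (h : HasTwoRainbowVertices G) (f : G ↪g H) : HasTwoRainbowVertices H := by
  obtain ⟨z₁, z₂, a₁, a₂, b₁, b₂, h⟩ := h
  exact ⟨f z₁, f z₂, f a₁, f a₂, f b₁, f b₂, by simpa [f.map_adj_iff] using h⟩

theorem HasBranching.map {V W : Type*} {G : SimpleGraph V} {H : SimpleGraph W}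
    (h : HasBranching G) (f : G ↪g H) : HasBranching H := by
  obtain ⟨z, a, b, h⟩ := h
  exact ⟨f z, f a, f b, by simpa [f.map_adj_iff] using h⟩

theorem hasBranching_starGraph {m : ℕ} (hm : 2 ≤ m) : HasBranching (starGraph m) :=
  ⟨⟨0, by omega⟩, ⟨1, by omega⟩, ⟨2, by omega⟩, by simp [starGraph_adj]⟩

theorem hasBranching_starPlusGraph {m : ℕ} (hm : 2 ≤ m) : HasBranching (starPlusGraph m) :=
  ⟨⟨0, by omega⟩, ⟨1, by omega⟩, ⟨2, by omega⟩, by simp [starPlusGraph_adj]⟩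

theorem hasBranching_doubleStar_one {m : ℕ} (hm : 1 ≤ m) : HasBranching (doubleStar m 1) :=
  ⟨⟨0, by omega⟩, ⟨1, by omega⟩, ⟨2, by omega⟩, by simp [doubleStar_one_adj]; omega⟩

theorem hasBranching_cycleGraph_five : HasBranching (SimpleGraph.cycleGraph 5) :=
  ⟨0, 1, 4, by decide⟩

theorem exists_equiv_fin_extending {α : Type*} [Fintype α] {N : ℕ} (hN : Fintype.card α = N)
    (s : Finset α) (f : α → ℕ) (hlt : ∀ i ∈ s, f i < N) (hf : Set.InjOn f s) :
    ∃ e : α ≃ Fin N, ∀ i ∈ s, (e i : ℕ) = f i := by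
  obtain ⟨g, hg⟩ := Finset.exists_equiv_extend_of_card_eq (t := Finset.range N) (s := s) (f := f)
    (by simpa using hN) (by simpa [Finset.subset_iff] using hlt) hf
  exact ⟨g.trans ⟨fun x => ⟨x, Finset.mem_range.1 x.2⟩, fun x => ⟨x, Finset.mem_range.2 x.2⟩,
    fun _ => rfl, fun _ => rfl⟩, hg⟩

theorem Equiv.val_eq_iff_of_val_eq {α : Type*} {N : ℕ} (e : α ≃ Fin N) {x : α} {k : ℕ}
    (hx : (e x : ℕ) = k) (a : α) : (e a : ℕ) = k ↔ a = x := by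
  rw [← hx, ← Fin.ext_iff, e.apply_eq_iff_eq]

theorem IsStar.nonempty_iso {V : Type*} [Fintype V] {G : SimpleGraph V} (h : IsStar G)
    {m : ℕ} (hm : Fintype.card V = m + 1) : Nonempty (G ≃g starGraph m) := by
  obtain ⟨v, h⟩ := h
  obtain ⟨e, he⟩ := exists_equiv_fin_extending hm {v} (fun _ => 0) (by simp) (by simp)
  have hv := e.val_eq_iff_of_val_eq (he v (by simp))
  refine ⟨⟨e, fun {a b} => ?_⟩⟩
  rw [starGraph_adj, h]
  simp only [hv, Ne]

theorem IsStarPlus.three_le_card {V : Type*} [Fintype V] {G : SimpleGraph V} (h : IsStarPlus G) :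
    3 ≤ Fintype.card V := by
  obtain ⟨v, x, y, hvx, hvy, hxy, -⟩ := h
  exact (Finset.two_lt_card_iff (s := Finset.univ)).2 ⟨v, x, y, by simp [*]⟩

theorem IsStarPlus.nonempty_iso {V : Type*} [Fintype V] {G : SimpleGraph V} (h : IsStarPlus G)
    {m : ℕ} (hm : Fintype.card V = m + 1) : Nonempty (G ≃g starPlusGraph m) := by
  have hcard := h.three_le_card
  obtain ⟨v, x, y, hvx, hvy, hxy, h⟩ := h
  obtain ⟨e, he⟩ := exists_equiv_fin_extending hm {v, x, y}
    (fun u => if u = v then 0 else if u = x then 1 else 2)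
    (by intro i _; split_ifs <;> omega) (by intro i hi j hj hij; simp at *; grind)
  have hv := e.val_eq_iff_of_val_eq (he v (by simp))
  have hx := e.val_eq_iff_of_val_eq (he x (by simp))
  have hy := e.val_eq_iff_of_val_eq (he y (by simp))
  simp only [hvx.symm, hvy.symm, hxy.symm, if_true, if_false] at hv hx hy
  refine ⟨⟨e, fun {a b} => ?_⟩⟩
  rw [starPlusGraph_adj, h]
  simp only [hv, hx, hy, Ne]

theorem IsStarWithPendant.four_le_card {V : Type*} [Fintype V] {G : SimpleGraph V}
    (h : IsStarWithPendant G) : 4 ≤ Fintype.card V := by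
  obtain ⟨v, x, w, u, hvx, hvw, hxw, huv, hux, huw, -⟩ := h
  have : ({v, x, w, u} : Finset V).card = 4 := by
    simp [Finset.card_insert_of_notMem, *, huv.symm, hux.symm, huw.symm]
  exact this ▸ Finset.card_le_univ _

theorem IsStarWithPendant.nonempty_iso {V : Type*} [Fintype V] {G : SimpleGraph V}
    (h : IsStarWithPendant G) {m : ℕ} (hm : Fintype.card V = m + 1 + 2) :
    Nonempty (G ≃g doubleStar m 1) := by
  have hcard := h.four_le_card
  obtain ⟨v, x, w, u, hvx, hvw, hxw, huv, hux, huw, h⟩ := h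
  obtain ⟨e, he⟩ := exists_equiv_fin_extending hm {v, x, w}
    (fun u => if u = v then 0 else if u = x then 1 else m + 2)
    (by intro i _; split_ifs <;> omega) (by intro i hi j hj hij; simp at *; grind)
  have hv := e.val_eq_iff_of_val_eq (he v (by simp))
  have hx := e.val_eq_iff_of_val_eq (he x (by simp))
  have hw := e.val_eq_iff_of_val_eq (he w (by simp))
  simp only [hvx.symm, hvw.symm, hxw.symm, if_true, if_false] at hv hx hw
  refine ⟨⟨e, fun {a b} => ?_⟩⟩
  rw [doubleStar_one_adj, h]
  simp only [hv, hx, hw, Ne]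

theorem IsFiveCycle.nonempty_iso {V : Type*} {G : SimpleGraph V} (h : IsFiveCycle G) :
    Nonempty (G ≃g SimpleGraph.cycleGraph 5) := by
  obtain ⟨p, hp, h⟩ := h
  let e : SimpleGraph.cycleGraph 5 ≃g G :=
    ⟨Equiv.ofBijective p hp, fun {i j} => (h i j).trans SimpleGraph.cycleGraph_adj.symm⟩
  exact ⟨e.symm⟩

theorem HasBranching.three_le_card {V : Type*} [Fintype V] {G : SimpleGraph V}
    (h : HasBranching G) : 3 ≤ Fintype.card V := by
  obtain ⟨z, a, b, ha, hb, hab⟩ := h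
  exact (Finset.two_lt_card_iff (s := Finset.univ)).2 ⟨z, a, b, by simp [ha.ne, hb.ne, hab]⟩

theorem classification_of_hasBranching {V : Type*} {G : SimpleGraph V} (hG : G.Connected)
    (hT : ¬ HasTwoRainbowVertices G) (hB : HasBranching G) :
    IsStar G ∨ IsStarPlus G ∨ IsStarWithPendant G ∨ IsFiveCycle G := by
  by_cases hdeg : ∀ v a b c, G.Adj v a → G.Adj v b → G.Adj v c → a = b ∨ a = c ∨ b = c
  · obtain ⟨z, a, b, ha, hb, hab⟩ := hB
    exact classification_of_degree_le_two hG hT hdeg ha hb hab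
  · push Not at hdeg
    obtain ⟨v, a, b, c, ha, hb, hc, hab, hac, hbc⟩ := hdeg
    have := star_classification_of_three_neighbors hG hT ha hb hc hab hac hbc
    tauto

theorem iso_top_of_not_hasBranching {V : Type*} {G : SimpleGraph V} (hG : G.Connected)
    (hB : ¬ HasBranching G) :
    Nonempty (G ≃g (⊤ : SimpleGraph (Fin 1))) ∨ Nonempty (G ≃g (⊤ : SimpleGraph (Fin 2))) := by
  obtain ⟨u⟩ := hG.nonempty
  by_cases hu : ∃ w, G.Adj u w
  · obtain ⟨w, huw⟩ := hu
    right
    have hall : ∀ x, x = u ∨ x = w := by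
      refine hG.mem_of_adj_closed (S := {x | x = u ∨ x = w}) (Or.inl rfl) ?_
      rintro a (rfl | rfl) b hab
      · by_contra! h
        exact hB ⟨a, w, b, huw, hab, fun e => h (Or.inr e.symm)⟩
      · by_contra! h
        exact hB ⟨a, u, b, huw.symm, hab, fun e => h (Or.inl e.symm)⟩
    let e : (⊤ : SimpleGraph (Fin 2)) ≃g G :=
      ⟨Equiv.ofBijective ![u, w] ⟨by
        intro i j hij
        have := huw.ne
        fin_cases i <;> fin_cases j <;> simp_all, fun x => by
        rcases hall x with rfl | rfl
        exacts [⟨0, rfl⟩, ⟨1, rfl⟩]⟩, fun {i j} => by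
        have h01 : G.Adj (![u, w] 0) (![u, w] 1) := huw
        fin_cases i <;> fin_cases j <;> simp
        exacts [h01, h01.symm]⟩
    exact ⟨e.symm⟩
  · left
    have hall : ∀ x, x = u := by
      refine hG.mem_of_adj_closed (S := {x | x = u}) rfl ?_
      rintro a rfl b hab
      exact absurd ⟨b, hab⟩ hu
    let e : (⊤ : SimpleGraph (Fin 1)) ≃g G :=
      ⟨Equiv.ofBijective ![u] ⟨fun i j _ => Subsingleton.elim _ _, fun x => ⟨0, (hall x).symm⟩⟩,
        fun {i j} => by simp [Subsingleton.elim i j]⟩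
    exact ⟨e.symm⟩

theorem hasBranching_induce_supp {V : Type*} {G : SimpleGraph V} (c : G.ConnectedComponent)
    {z a b : V} (hz : z ∈ c.supp) (ha : G.Adj z a) (hb : G.Adj z b) (hab : a ≠ b) :
    HasBranching (G.induce c.supp) :=
  ⟨⟨z, hz⟩, ⟨a, c.mem_supp_of_adj_mem_supp hz ha⟩, ⟨b, c.mem_supp_of_adj_mem_supp hz hb⟩, ha, hb,
    fun h => hab (congrArg Subtype.val h)⟩

theorem HasBranching.hasTwoRainbowVertices_of_ne {V : Type*} {G : SimpleGraph V}
    {c d : G.ConnectedComponent} (hcd : d ≠ c) (hc : HasBranching (G.induce c.supp))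
    (hd : HasBranching (G.induce d.supp)) : HasTwoRainbowVertices G := by
  have hne : ∀ (x : c.supp) (y : d.supp), (x : V) ≠ y := fun x y h =>
    hcd (y.2.symm.trans (h ▸ x.2))
  have hadj : ∀ (x : c.supp) (y : d.supp), ¬ G.Adj x y := fun x y h =>
    hne ⟨y, c.mem_supp_of_adj_mem_supp x.2 h⟩ y rfl
  obtain ⟨z, a, b, ha, hb, hab⟩ := hc
  obtain ⟨z', a', b', ha', hb', hab'⟩ := hd
  exact ⟨z, z', a, a', b, b', hne z z', ha, hb, ha', hb', hadj a a', hadj b b',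
    fun h => hab (Subtype.ext h), hne a b', (hne b a').symm, fun h => hab' (Subtype.ext h)⟩

theorem not_hasBranching_of_iso_top {V : Type*} {G : SimpleGraph V}
    (h : Nonempty (G ≃g (⊤ : SimpleGraph (Fin 1))) ∨ Nonempty (G ≃g (⊤ : SimpleGraph (Fin 2)))) :
    ¬ HasBranching G := by
  rintro hB
  obtain ⟨⟨e⟩⟩ | ⟨⟨e⟩⟩ := h <;>
  · have := (hB.map e.toEmbedding).three_le_card
    simp at this

theorem HasTwoRainbowVertices.induce_supp {V : Type*} {G : SimpleGraph V}
    (h : HasTwoRainbowVertices G) {c : G.ConnectedComponent}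
    (hc : ∀ d : G.ConnectedComponent, d ≠ c → ¬ HasBranching (G.induce d.supp)) :
    HasTwoRainbowVertices (G.induce c.supp) := by
  obtain ⟨z₁, z₂, a₁, a₂, b₁, b₂, hz, h1, h2, h3, h4, ha, hb, n1, n2, n3, n4⟩ := h
  have hmem : ∀ z a b, G.Adj z a → G.Adj z b → a ≠ b → z ∈ c.supp := by
    intro z a b ha hb hab
    by_contra hz
    exact hc (G.connectedComponentMk z) hz (hasBranching_induce_supp _ rfl ha hb hab)
  have hz₁ := hmem z₁ a₁ b₁ h1 h2 n1
  have hz₂ := hmem z₂ a₂ b₂ h3 h4 n4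
  exact ⟨⟨z₁, hz₁⟩, ⟨z₂, hz₂⟩, ⟨a₁, c.mem_supp_of_adj_mem_supp hz₁ h1⟩,
    ⟨a₂, c.mem_supp_of_adj_mem_supp hz₂ h3⟩, ⟨b₁, c.mem_supp_of_adj_mem_supp hz₁ h2⟩,
    ⟨b₂, c.mem_supp_of_adj_mem_supp hz₂ h4⟩,
    by simpa using ⟨hz, h1, h2, h3, h4, ha, hb, n1, n2, n3, n4⟩⟩

theorem stmt_2 {V : Type*} [Fintype V] (G : SimpleGraph V) (n : ℕ)
    (hcard : Fintype.card V = n) (hn : 3 ≤ n) :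
    riNumber G 2 = n - 1 ↔
      ∃ c : G.ConnectedComponent,
        ((3 ≤ Fintype.card ↥c.supp ∧
            Nonempty (G.induce c.supp ≃g starGraph (Fintype.card ↥c.supp - 1))) ∨
         (3 ≤ Fintype.card ↥c.supp ∧
            Nonempty (G.induce c.supp ≃g starPlusGraph (Fintype.card ↥c.supp - 1))) ∨
         (4 ≤ Fintype.card ↥c.supp ∧
            Nonempty (G.induce c.supp ≃g doubleStar (Fintype.card ↥c.supp - 3) 1)) ∨
         Nonempty (G.induce c.supp ≃g SimpleGraph.cycleGraph 5)) ∧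
        ∀ d : G.ConnectedComponent, d ≠ c →
          (Nonempty (G.induce d.supp ≃g (⊤ : SimpleGraph (Fin 1))) ∨
           Nonempty (G.induce d.supp ≃g (⊤ : SimpleGraph (Fin 2)))) := by
  have hiff : riNumber G 2 = n - 1 ↔ riNumber G 2 + 1 = Fintype.card V := by omega
  rw [hiff, riNumber_two_add_one_eq_card_iff]
  constructor
  · rintro ⟨hT, z, a, b, ha, hb, hab⟩
    have hBc := hasBranching_induce_supp (G.connectedComponentMk z) rfl ha hb hab
    generalize G.connectedComponentMk z = c at hBc
    refine ⟨c, ?_, fun d hd => iso_top_of_not_hasBranching d.connected_toSimpleGraph fun hBd =>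
      hT (hBc.hasTwoRainbowVertices_of_ne hd hBd)⟩
    have hcard := hBc.three_le_card (V := c.supp)
    obtain h | h | h | h := classification_of_hasBranching c.connected_toSimpleGraph
      (fun h => hT (h.map (SimpleGraph.Embedding.induce _))) hBc
    · exact Or.inl ⟨hcard, h.nonempty_iso (V := c.supp) (by omega)⟩
    · exact Or.inr (Or.inl ⟨hcard, h.nonempty_iso (V := c.supp) (by omega)⟩)
    · have := h.four_le_card (V := c.supp)
      exact Or.inr (Or.inr (Or.inl ⟨this, h.nonempty_iso (V := c.supp) (by omega)⟩))
    · exact Or.inr (Or.inr (Or.inr h.nonempty_iso))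
  · rintro ⟨c, hc, hd⟩
    suffices h : ¬ HasTwoRainbowVertices (G.induce c.supp) ∧ HasBranching (G.induce c.supp) from
      ⟨fun hT => h.1 (hT.induce_supp fun d hdc => not_hasBranching_of_iso_top (hd d hdc)),
        h.2.map (SimpleGraph.Embedding.induce _)⟩
    obtain ⟨hcard, ⟨e⟩⟩ | ⟨hcard, ⟨e⟩⟩ | ⟨hcard, ⟨e⟩⟩ | ⟨⟨e⟩⟩ := hc
    · exact ⟨fun h => not_hasTwoRainbowVertices_starGraph _ (h.map e.toEmbedding),
        (hasBranching_starGraph (by omega)).map e.symm.toEmbedding⟩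
    · exact ⟨fun h => not_hasTwoRainbowVertices_starPlusGraph _ (h.map e.toEmbedding),
        (hasBranching_starPlusGraph (by omega)).map e.symm.toEmbedding⟩
    · exact ⟨fun h => not_hasTwoRainbowVertices_doubleStar_one _ (h.map e.toEmbedding),
        (hasBranching_doubleStar_one (by omega)).map e.symm.toEmbedding⟩
    · exact ⟨fun h => not_hasTwoRainbowVertices_cycleGraph_five (h.map e.toEmbedding),
        hasBranching_cycleGraph_five.map e.symm.toEmbedding⟩
end

section
/- Let G be a graph of order n ≥ 4 and u a vertex of G. If the graph H = G − u obtained by deleting u and its incident edges is connected and γ_ri2(H) = |V(H)| − 1, then G has a 2RiDF f such that f(u) = 1 and f(v) = 0 for some vertex v of H. -/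
open scoped Classical

/-- An independent set avoiding `T` extends to one that avoids `T` and dominates every
other vertex outside `T`. -/
theorem exists_indepSet_dominating_compl {V : Type*} [Finite V] (G : SimpleGraph V) {S T : Set V}
    (hS : G.IsIndepSet S) (hST : Disjoint S T) :
    ∃ I, S ⊆ I ∧ G.IsIndepSet I ∧ Disjoint I T ∧ ∀ w, w ∉ I → w ∉ T → ∃ x ∈ I, G.Adj w x := by
  obtain ⟨I, hSI, hI⟩ := (Set.toFinite {I : Set V | G.IsIndepSet I ∧ Disjoint I T}).exists_le_maximal
    (a := S) ⟨hS, hST⟩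
  refine ⟨I, hSI, hI.prop.1, hI.prop.2, fun w hwI hwT => ?_⟩
  by_contra! h
  refine hwI (hI.le_of_ge (y := insert w I) ⟨?_, ?_⟩ (Set.subset_insert w I)
    (Set.mem_insert w I))
  · exact Set.pairwise_insert.2 ⟨hI.prop.1, fun x hx _ => ⟨h x hx, fun e => h x hx e.symm⟩⟩
  · exact Set.disjoint_insert_left.2 ⟨hwT, hI.prop.2⟩

/-- Disjoint independent sets extend to the colour classes of a 2-rainbow independent
dominating function. -/
theorem exists_isKRiDF_two_of_indepSet {V : Type*} [Finite V] (G : SimpleGraph V) {S T : Set V}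
    (hS : G.IsIndepSet S) (hT : G.IsIndepSet T) (hST : Disjoint S T) :
    ∃ f : V → ℕ, IsKRiDF G 2 f ∧ (∀ v ∈ S, f v = 1) ∧ ∀ v ∈ T, f v = 2 := by
  obtain ⟨I, hSI, hI, hIT, hId⟩ := exists_indepSet_dominating_compl G hS hST
  obtain ⟨J, hTJ, hJ, hJI, hJd⟩ := exists_indepSet_dominating_compl G hT hIT.symm
  have hdisj : ∀ v ∈ J, v ∉ I := fun v hv hv' => Set.disjoint_left.1 hJI hv hv'
  let f : V → ℕ := fun v => if v ∈ I then 1 else if v ∈ J then 2 else 0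
  have f1 : ∀ v, f v = 1 ↔ v ∈ I := fun v => by simp only [f]; split_ifs <;> simp_all
  have f2 : ∀ v, f v = 2 ↔ v ∈ J := fun v => by
    have := hdisj v
    simp only [f]; grind
  refine ⟨f, ⟨fun v => by simp only [f]; split_ifs <;> simp, ?_, ?_⟩,
    fun v hv => (f1 v).2 (hSI hv), fun v hv => (f2 v).2 (hTJ hv)⟩
  · intro i hi1 hi2 a b ha hb hab
    obtain rfl | rfl : i = 1 ∨ i = 2 := by lia
    · exact hI ((f1 a).1 ha) ((f1 b).1 hb) hab.ne hab
    · exact hJ ((f2 a).1 ha) ((f2 b).1 hb) hab.ne hab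
  · intro v hv i hi1 hi2
    have hvI : v ∉ I := fun h => by simp [(f1 v).2 h] at hv
    have hvJ : v ∉ J := fun h => by simp [(f2 v).2 h] at hv
    obtain rfl | rfl : i = 1 ∨ i = 2 := by lia
    · obtain ⟨x, hx, hvx⟩ := hId v hvI fun h => hvJ (hTJ h)
      exact ⟨x, hvx, (f1 x).2 hx⟩
    · obtain ⟨x, hx, hvx⟩ := hJd v hvJ hvI
      exact ⟨x, hvx, (f2 x).2 hx⟩

/-- A vertex with neighbours of both colours has value zero. -/
theorem IsKRiDF.eq_zero_of_adj {V : Type*} {G : SimpleGraph V} {f : V → ℕ}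
    (hf : IsKRiDF G 2 f) {v a b : V} (ha : G.Adj v a) (hb : G.Adj v b)
    (hfa : f a = 1) (hfb : f b = 2) : f v = 0 := by
  have h1 : f v ≠ 1 := fun h => hf.2.1 1 le_rfl one_le_two v a h hfa ha
  have h2 : f v ≠ 2 := fun h => hf.2.1 2 one_le_two le_rfl v b h hfb hb
  have := hf.1 v
  lia

/-- A nonempty proper vertex set of a connected graph has a boundary edge. -/
theorem SimpleGraph.Preconnected.exists_adj_mem_notMem {V : Type*} {G : SimpleGraph V}
    (hG : G.Preconnected) {S : Set V} {x y : V} (hx : x ∈ S) (hy : y ∉ S) :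
    ∃ a ∈ S, ∃ b ∉ S, G.Adj a b := by
  obtain ⟨p⟩ := hG x y
  obtain ⟨d, -, h1, h2⟩ := p.exists_boundary_dart S hx hy
  exact ⟨_, h1, _, h2, d.adj⟩

theorem stmt_8 {V : Type*} [Fintype V] (G : SimpleGraph V) (n : ℕ)
    (hcard : Fintype.card V = n) (hn : 4 ≤ n) (u : V)
    (hconn : (G.induce ({u}ᶜ : Set V)).Connected)
    (hH : riNumber (G.induce ({u}ᶜ : Set V)) 2 = Fintype.card ↥({u}ᶜ : Set V) - 1) :
    ∃ f : V → ℕ, IsKRiDF G 2 f ∧ f u = 1 ∧ ∃ v : V, v ≠ u ∧ f v = 0 := by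
  have hfresh : ∀ x y : V, ∃ z, z ≠ u ∧ z ≠ x ∧ z ≠ y := fun x y => by
    obtain ⟨z, hz⟩ := Finset.exists_mem_notMem_of_card_lt_card
      (s := {u, x, y}) (t := Finset.univ) (by
        have := Finset.card_le_three (a := u) (b := x) (c := y)
        rw [Finset.card_univ]; lia)
    exact ⟨z, by simpa using hz⟩
  have hnbr : ∀ v, v ≠ u → ∃ b, b ≠ u ∧ G.Adj v b := fun v hv => by
    obtain ⟨z, hzu, hzv, -⟩ := hfresh v v
    obtain ⟨a, ha, b, -, hab⟩ := hconn.preconnected.exists_adj_mem_notMem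
      (S := {⟨v, hv⟩}) (x := ⟨v, hv⟩) (y := ⟨z, hzu⟩) rfl (by simpa [Subtype.ext_iff] using hzv)
    obtain rfl := Set.mem_singleton_iff.1 ha
    exact ⟨b, b.2, hab⟩
  by_cases hu : ∃ v, G.Adj v u
  · obtain ⟨v, hvu⟩ := hu
    obtain ⟨b, hbu, hvb⟩ := hnbr v hvu.ne
    obtain ⟨f, hf, hf1, hf2⟩ := exists_isKRiDF_two_of_indepSet G (S := {u}) (T := {b})
      (Set.pairwise_singleton _ _) (Set.pairwise_singleton _ _) (by simpa using hbu.symm)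
    exact ⟨f, hf, hf1 u rfl, v, hvu.ne, hf.eq_zero_of_adj hvu hvb (hf1 u rfl) (hf2 b rfl)⟩
  · push Not at hu
    obtain ⟨v, a, b, hvu, hau, hbu, hab, hva, hvb⟩ : ∃ v a b, v ≠ u ∧ a ≠ u ∧ b ≠ u ∧ a ≠ b ∧
        G.Adj v a ∧ G.Adj v b := by
      obtain ⟨x, hxu, -⟩ := hfresh u u
      obtain ⟨y, hyu, hxy⟩ := hnbr x hxu
      obtain ⟨z, hzu, hzx, hzy⟩ := hfresh x y
      obtain ⟨v, hv, b, hb, hvb⟩ := hconn.preconnected.exists_adj_mem_notMem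
        (S := {⟨x, hxu⟩, ⟨y, hyu⟩}) (x := ⟨x, hxu⟩) (y := ⟨z, hzu⟩) (by simp)
        (by simp [Subtype.ext_iff, hzx, hzy])
      have hb' : (b : V) ≠ x ∧ (b : V) ≠ y := by simpa [Subtype.ext_iff] using hb
      obtain rfl | rfl := hv
      · exact ⟨x, y, b, hxu, hyu, b.2, hb'.2.symm, hxy, hvb⟩
      · exact ⟨y, x, b, hyu, hxu, b.2, hb'.1.symm, hxy.symm, hvb⟩
    obtain ⟨f, hf, hf1, hf2⟩ := exists_isKRiDF_two_of_indepSet G (S := {u, a}) (T := {b})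
      (Set.pairwise_pair.2 fun _ => ⟨fun h => hu a h.symm, hu a⟩)
      (Set.pairwise_singleton _ _) (by simp [hbu, hab.symm])
    exact ⟨f, hf, hf1 u (by simp), v, hvu,
      hf.eq_zero_of_adj hva hvb (hf1 a (by simp)) (hf2 b rfl)⟩
end
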